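/- Let A1, A2, B1, B2 be pairwise disjoint finite sets with |A1| ≥ |B1| ≥ 1 and |A2| ≥ |B2| ≥ 1, and let G1, G2, G3 and w be as in the combined setup. Let M1 be an optimal MCM for BOT(G1) such that e1 = {a1, b1} ∈ M1 (with a1 ∈ A1, b1 ∈ B1) is a critical bottleneck edge of G1 relative to M1, e1 is the unique element of argmax_{e∈M1} w(e), and G1 is a bottleneck cluster relative to e1; let M2 be an optimal MCM for BOT(G2) such that e2 ∈ M2 is a critical bottleneck edge of G2 relative to M2 and G2 is a bottleneck cluster relative to e2; assume w(e1) > w(e2). Define V_ν := {b1} ∪ {v ∈ A1∪B1 : there is an alternating path P ⊆ φ(G1,M1)\{e1} relative to M1 between v and b1} and V_μ := (A1∪B1)\V_ν. Then a bottleneck edge e3 of G3 satisfies w(e3) < w(e1) if and only if there exist an agent i ∈ A2 and a task j ∈ B2 such that: (i) there exists a task b' ∈ V_ν ∩ B1 with w({i, b'}) < w(e1); (ii) there exists an agent a' ∈ V_μ ∩ A1 with w({j, a'}) < w(e1); and (iii) there exists an alternating path P relative to M2 between i and j all of whose edges have weight less than w(e1) and which satisfies |P ∩ M2| > |P \ M2|.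 -/

import Mathlib

/-- Edge set of the complete bipartite graph with parts `A` (agents) and `B` (tasks). -/
def bipEdges {V : Type*} [DecidableEq V] (A B : Finset V) : Finset (Sym2 V) :=
  (A ×ˢ B).image (fun p => s(p.1, p.2))

/-- `M` is a matching in the graph with edge set `E`: a set of edges of `E` such that
no vertex is incident with more than one edge of `M`. -/
def IsMatching {V : Type*} (E M : Finset (Sym2 V)) : Prop :=
  M ⊆ E ∧ ∀ v : V, ∀ e₁ ∈ M, ∀ e₂ ∈ M, v ∈ e₁ → v ∈ e₂ → e₁ = e₂

/-- `M` is a maximum cardinality matching of the graph with edge set `E`. -/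
def IsMCM {V : Type*} (E M : Finset (Sym2 V)) : Prop :=
  IsMatching E M ∧ ∀ M' : Finset (Sym2 V), IsMatching E M' → M'.card ≤ M.card

/-- `e` attains the maximum weight among the edges of `M`, i.e. `e ∈ argmax_{e' ∈ M} w e'`. -/
def IsMaxEdge {V : Type*} (w : Sym2 V → ℝ) (M : Finset (Sym2 V)) (e : Sym2 V) : Prop :=
  e ∈ M ∧ ∀ e' ∈ M, w e' ≤ w e

/-- `M` is an optimal solution to the bottleneck assignment problem `BOT` on the graph with
edge set `E`: it is an MCM whose maximum edge weight is no larger than that of any MCM. -/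
def IsOptMCM {V : Type*} (E : Finset (Sym2 V)) (w : Sym2 V → ℝ) (M : Finset (Sym2 V)) : Prop :=
  IsMCM E M ∧ ∀ M' e e', IsMCM E M' → IsMaxEdge w M e → IsMaxEdge w M' e' → w e ≤ w e'

/-- `e` is a bottleneck edge: it attains the maximum weight in some optimal MCM. -/
def IsBottleneckEdge {V : Type*} (E : Finset (Sym2 V)) (w : Sym2 V → ℝ) (e : Sym2 V) : Prop :=
  ∃ M, IsOptMCM E w M ∧ IsMaxEdge w M e

/-- `P` is a path between `u` and `v` whose edges all lie in `E`: it is the set of consecutive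
edges of a sequence of distinct vertices `u = v₁, v₂, …, v_{l+1} = v` (with `l ≥ 1`). -/
def IsPath {V : Type*} [DecidableEq V] (E P : Finset (Sym2 V)) (u v : V) : Prop :=
  ∃ l : List V, l.Nodup ∧ 2 ≤ l.length ∧ l.head? = some u ∧ l.getLast? = some v ∧
    (∀ e ∈ List.zipWith (fun a b => s(a, b)) l l.tail, e ∈ E) ∧
    P = (List.zipWith (fun a b => s(a, b)) l l.tail).toFinset

/-- The alternation condition: every vertex is incident with at most one edge of `P ∩ M`
and at most one edge of `P \ M`. -/
def AltCond {V : Type*} [DecidableEq V] (M P : Finset (Sym2 V)) : Prop :=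
  (∀ x : V, ∀ e₁ ∈ P ∩ M, ∀ e₂ ∈ P ∩ M, x ∈ e₁ → x ∈ e₂ → e₁ = e₂) ∧
  (∀ x : V, ∀ e₁ ∈ P \ M, ∀ e₂ ∈ P \ M, x ∈ e₁ → x ∈ e₂ → e₁ = e₂)

/-- `P` is an alternating path relative to the matching `M`, between `u` and `v`, with all
edges in `E`. -/
def IsAltPath {V : Type*} [DecidableEq V] (E M P : Finset (Sym2 V)) (u v : V) : Prop :=
  IsPath E P u v ∧ AltCond M P

/-- `v` is a free vertex relative to the matching `M`. -/
def IsFree {V : Type*} (M : Finset (Sym2 V)) (v : V) : Prop :=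
  ∀ e ∈ M, v ∉ e

/-- `P` is an augmenting path relative to the matching `M`, between the free vertices `u`
and `v`, with all edges in `E`. -/
def IsAugPath {V : Type*} [DecidableEq V] (E M P : Finset (Sym2 V)) (u v : V) : Prop :=
  IsAltPath E M P u v ∧ IsFree M u ∧ IsFree M v

open Classical in
/-- `φ(G, M)`: the union of `M` with the set of edges of `E` of weight strictly smaller than
the largest weight of an edge of `M`. -/
noncomputable def phi {V : Type*} [DecidableEq V] (E : Finset (Sym2 V)) (w : Sym2 V → ℝ)
    (M : Finset (Sym2 V)) : Finset (Sym2 V) :=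
  M ∪ E.filter (fun e => ∃ e', IsMaxEdge w M e' ∧ w e < w e')

/-- `e` is a critical bottleneck edge of the graph with edge set `E` relative to the matching
`M`: it attains the maximum weight in `M` and `φ(G,M) \ {e}` contains no augmenting path
relative to `M \ {e}`. -/
def IsCritBotEdge {V : Type*} [DecidableEq V] (E : Finset (Sym2 V)) (w : Sym2 V → ℝ)
    (M : Finset (Sym2 V)) (e : Sym2 V) : Prop :=
  IsMaxEdge w M e ∧ ¬ ∃ P u v, IsAugPath (phi E w M \ {e}) (M \ {e}) P u v

/-- The complete bipartite graph on parts `A`, `B` is a bottleneck cluster relative to a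
bottleneck edge with task endpoint `b`, for the optimal MCM `Mb`: every vertex is connected
to `b` by an alternating path contained in `φ(G, Mb)` relative to `Mb`. -/
def IsBotCluster {V : Type*} [DecidableEq V] (A B : Finset V) (w : Sym2 V → ℝ)
    (Mb : Finset (Sym2 V)) (b : V) : Prop :=
  ∀ v ∈ A ∪ B, v ≠ b → ∃ P, IsAltPath (phi (bipEdges A B) w Mb) Mb P v b

/-- The graph with vertex set `Vs` and edge set `Es` is a tree: edges join vertices of `Vs`
and there is a unique path between any two distinct vertices. -/
def IsTreeOn {V : Type*} [DecidableEq V] (Vs : Finset V) (Es : Finset (Sym2 V)) : Prop :=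
  (∀ e ∈ Es, ∀ x ∈ e, x ∈ Vs) ∧
  ∀ u ∈ Vs, ∀ v ∈ Vs, u ≠ v → ∃! P, IsPath Es P u v

/-- The graph `(Vs, Es)` is an alternating tree relative to the matching `M`, rooted at `r`:
it is a tree and every path from the root `r` to another vertex is an alternating path
relative to `M`. -/
def IsAltTree {V : Type*} [DecidableEq V] (M : Finset (Sym2 V)) (r : V) (Vs : Finset V)
    (Es : Finset (Sym2 V)) : Prop :=
  r ∈ Vs ∧ IsTreeOn Vs Es ∧ ∀ v ∈ Vs, ∀ P, IsPath Es P r v → AltCond M P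

/-- The vertex set `V_ν` associated with the bottleneck cluster `G1` relative to the critical
bottleneck edge `e1 = {a1, b1}`: the bottleneck task `b1` together with all vertices of `G1`
connected to `b1` by an alternating path `P ⊆ φ(G1, M1) \ {e1}` relative to `M1`. -/
def Vnu {V : Type*} [DecidableEq V] (A1 B1 : Finset V) (w : Sym2 V → ℝ)
    (M1 : Finset (Sym2 V)) (a1 b1 : V) : Set V :=
  insert b1 {v | v ∈ A1 ∪ B1 ∧
    ∃ P, IsAltPath (phi (bipEdges A1 B1) w M1 \ {s(a1, b1)}) M1 P v b1}

/-- The complementary vertex set `V_μ := (A1 ∪ B1) \ V_ν`. -/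
def Vmu {V : Type*} [DecidableEq V] (A1 B1 : Finset V) (w : Sym2 V → ℝ)
    (M1 : Finset (Sym2 V)) (a1 b1 : V) : Set V :=
  (↑(A1 ∪ B1) : Set V) \ Vnu A1 B1 w M1 a1 b1

section AlternatingReachability

variable {V : Type*}

/-- One step along an edge of `E` which is outside `M` when it leaves a vertex of `X` and in `M`
when it leaves a vertex outside `X`. -/
def AltStep (X : Set V) (E M : Finset (Sym2 V)) (x y : V) : Prop :=
  s(x, y) ∈ E ∧ (x ∈ X ↔ s(x, y) ∉ M)

/-- Every edge of `E` joins `X` with its complement. -/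
def Crosses (X : Set V) (E : Finset (Sym2 V)) : Prop :=
  ∀ x y, s(x, y) ∈ E → (x ∈ X ↔ y ∉ X)

/-- The edges between consecutive entries of a list of vertices. -/
def pathEdges (l : List V) : List (Sym2 V) :=
  List.zipWith (fun a b => s(a, b)) l l.tail

theorem pathEdges_cons_cons (x y : V) (l : List V) :
    pathEdges (x :: y :: l) = s(x, y) :: pathEdges (y :: l) := rfl

theorem pathEdges_singleton (x : V) : pathEdges [x] = [] := rfl

theorem mem_of_mem_pathEdges {l : List V} {e : Sym2 V} {x : V} (he : e ∈ pathEdges l)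
    (hx : x ∈ e) : x ∈ l := by
  induction l with
  | nil => simp [pathEdges] at he
  | cons a l ih =>
    cases l with
    | nil => simp [pathEdges] at he
    | cons b l =>
      rw [pathEdges_cons_cons, List.mem_cons] at he
      rcases he with rfl | he
      · rcases Sym2.mem_iff.1 hx with rfl | rfl <;> simp
      · exact List.mem_cons_of_mem _ (ih he)

theorem Crosses.compl {X : Set V} {E : Finset (Sym2 V)} (h : Crosses X E) : Crosses Xᶜ E := by
  intro x y hxy
  have := h x y hxy
  simp only [Set.mem_compl_iff]
  tauto

theorem AltStep.swap {X : Set V} {E M : Finset (Sym2 V)} (hX : Crosses X E) {x y : V}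
    (h : AltStep X E M x y) : AltStep Xᶜ E M y x := by
  obtain ⟨h1, h2⟩ := h
  have := hX x y h1
  refine ⟨Sym2.eq_swap ▸ h1, ?_⟩
  rw [Sym2.eq_swap (a := y)]
  simp only [Set.mem_compl_iff]
  tauto

theorem reach_swap {X : Set V} {E M : Finset (Sym2 V)} (hX : Crosses X E) {x y : V}
    (h : Relation.ReflTransGen (AltStep X E M) x y) :
    Relation.ReflTransGen (AltStep Xᶜ E M) y x := by
  induction h with
  | refl => exact .refl
  | tail _ h ih => exact .head (h.swap hX) ih

theorem exists_nodup_chain {r : V → V → Prop} {u v : V} (h : Relation.ReflTransGen r u v) :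
    ∃ l : List V, (u :: l).Nodup ∧ (u :: l).IsChain r ∧ (u :: l).getLast? = some v := by
  induction h using Relation.ReflTransGen.head_induction_on with
  | refl => exact ⟨[], by simp⟩
  | @head a c hac _ ih =>
    obtain ⟨l, h1, h2, h3⟩ := ih
    by_cases ha : a ∈ c :: l
    · obtain ⟨s, t, hst⟩ := List.append_of_mem ha
      rw [hst] at h1 h2 h3
      refine ⟨t, h1.of_append_right, h2.right_of_append, ?_⟩
      simpa [List.getLast?_append] using h3
    · refine ⟨c :: l, List.nodup_cons.2 ⟨ha, h1⟩, List.isChain_cons_cons.2 ⟨hac, h2⟩, ?_⟩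
      simpa using h3

theorem reach_of_chain {r : V → V → Prop} {u v : V} {l : List V} (h : (u :: l).IsChain r)
    (hv : (u :: l).getLast? = some v) : Relation.ReflTransGen r u v := by
  induction l generalizing u with
  | nil =>
    simp at hv
    exact hv ▸ .refl
  | cons c l ih =>
    rw [List.isChain_cons_cons] at h
    exact .head h.1 (ih h.2 (by simpa using hv))

theorem edges_mem_of_altChain {X : Set V} {E M : Finset (Sym2 V)} {l : List V}
    (h : l.IsChain (AltStep X E M)) : ∀ e ∈ pathEdges l, e ∈ E := by
  induction l with
  | nil => simp [pathEdges]
  | cons u l ih =>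
    cases l with
    | nil => simp [pathEdges]
    | cons c l =>
      rw [List.isChain_cons_cons] at h
      intro e he
      rw [pathEdges_cons_cons, List.mem_cons] at he
      rcases he with rfl | he
      · exact h.1.1
      · exact ih h.2 e he

theorem eq_of_mem_pathEdges_head {y : V} {l : List V} (hn : (y :: l).Nodup) {e : Sym2 V}
    (he : e ∈ pathEdges (y :: l)) (hy : y ∈ e) : ∃ z t, l = z :: t ∧ e = s(y, z) := by
  cases l with
  | nil => simp [pathEdges] at he
  | cons z t =>
    rw [pathEdges_cons_cons, List.mem_cons] at he
    rcases he with rfl | he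
    · exact ⟨z, t, rfl, rfl⟩
    · exact absurd (mem_of_mem_pathEdges he hy) (List.nodup_cons.1 hn).1

theorem IsMatching.right_eq {E M : Finset (Sym2 V)} (h : IsMatching E M) {x y z : V}
    (h1 : s(x, y) ∈ M) (h2 : s(x, z) ∈ M) : y = z := by
  exact Sym2.congr_right.1 (h.2 x _ h1 _ h2 (by simp) (by simp))

theorem IsMatching.left_eq {E M : Finset (Sym2 V)} (h : IsMatching E M) {x y z : V}
    (h1 : s(y, x) ∈ M) (h2 : s(z, x) ∈ M) : y = z :=
  h.right_eq (Sym2.eq_swap ▸ h1) (Sym2.eq_swap ▸ h2)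

variable [DecidableEq V]

open Classical in
theorem card_of_altChain {X : Set V} {E M : Finset (Sym2 V)} (hX : Crosses X E) {u v : V}
    {l : List V} (hn : (u :: l).Nodup) (h : (u :: l).IsChain (AltStep X E M))
    (hv : (u :: l).getLast? = some v) :
    ((pathEdges (u :: l)).toFinset ∩ M).card + (if u ∈ X then 1 else 0) =
      ((pathEdges (u :: l)).toFinset \ M).card + (if v ∈ X then 1 else 0) := by
  induction l generalizing u with
  | nil =>
    simp at hv
    simp [pathEdges_singleton, hv]
  | cons c l ih =>
    rw [List.isChain_cons_cons] at h
    rw [List.nodup_cons] at hn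
    have ih := ih hn.2 h.2 (by simpa using hv)
    have hne : s(u, c) ∉ (pathEdges (c :: l)).toFinset := fun hmem =>
      hn.1 (mem_of_mem_pathEdges (List.mem_toFinset.1 hmem) (Sym2.mem_mk_left _ _))
    have hXu := hX u c h.1.1
    have hM := h.1.2
    rw [pathEdges_cons_cons, List.toFinset_cons]
    by_cases hu : u ∈ X
    · have h1 := hM.1 hu
      have h2 := hXu.1 hu
      rw [Finset.insert_inter_of_notMem h1, Finset.insert_sdiff_of_notMem _ h1,
        Finset.card_insert_of_notMem (by simp_all)]
      simp only [hu, h2, if_true, if_false] at ih ⊢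
      omega
    · have h1 : s(u, c) ∈ M := by tauto
      have h2 : c ∈ X := by tauto
      rw [Finset.insert_inter_of_mem h1, Finset.insert_sdiff_of_mem _ h1,
        Finset.card_insert_of_notMem (by simp_all)]
      simp only [hu, h2, if_true, if_false] at ih ⊢
      omega

theorem eq_of_altChain {X : Set V} {E M : Finset (Sym2 V)} (hX : Crosses X E) {l : List V}
    (hn : l.Nodup) (h : l.IsChain (AltStep X E M)) (x : V) :
    ∀ e₁ ∈ pathEdges l, ∀ e₂ ∈ pathEdges l, e₁ ∉ M → e₂ ∉ M → x ∈ e₁ → x ∈ e₂ → e₁ = e₂ := by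
  induction l with
  | nil => simp [pathEdges]
  | cons u l ih =>
    cases l with
    | nil => simp [pathEdges]
    | cons c l =>
      rw [List.isChain_cons_cons] at h
      rw [List.nodup_cons] at hn
      have key : ∀ e ∈ pathEdges (c :: l), s(u, c) ∉ M → e ∉ M → x ∈ s(u, c) → x ∈ e → False := by
        intro e he h1 h2 hx1 hx2
        rcases Sym2.mem_iff.1 hx1 with rfl | rfl
        · exact hn.1 (mem_of_mem_pathEdges he hx2)
        · obtain ⟨z, t, rfl, rfl⟩ := eq_of_mem_pathEdges_head hn.2 he hx2
          have h3 := (List.isChain_cons_cons.1 h.2).1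
          have := hX _ _ h.1.1
          have := h.1.2
          have := h3.2
          tauto
      intro e₁ he₁ e₂ he₂ h1 h2 hx1 hx2
      rw [pathEdges_cons_cons, List.mem_cons] at he₁ he₂
      rcases he₁ with rfl | he₁ <;> rcases he₂ with rfl | he₂
      · rfl
      · exact (key _ he₂ h1 h2 hx1 hx2).elim
      · exact (key _ he₁ h2 h1 hx2 hx1).elim
      · exact ih hn.2 h.2 e₁ he₁ e₂ he₂ h1 h2 hx1 hx2

open Classical in
theorem exists_altPath_of_reach {X : Set V} {E M : Finset (Sym2 V)} (hX : Crosses X E)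
    (hM : ∀ v : V, ∀ e₁ ∈ M, ∀ e₂ ∈ M, v ∈ e₁ → v ∈ e₂ → e₁ = e₂) {u v : V}
    (h : Relation.ReflTransGen (AltStep X E M) u v) (huv : u ≠ v) :
    ∃ P, IsAltPath E M P u v ∧ P ⊆ E ∧ (P ∩ M).card + (if u ∈ X then 1 else 0) =
      (P \ M).card + (if v ∈ X then 1 else 0) := by
  obtain ⟨l, hn, hc, hl⟩ := exists_nodup_chain h
  refine ⟨(pathEdges (u :: l)).toFinset, ⟨⟨u :: l, hn, ?_, rfl, hl,
    edges_mem_of_altChain hc, rfl⟩, ?_, ?_⟩, ?_, card_of_altChain hX hn hc hl⟩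
  · cases l with
    | nil => simp at hl; exact absurd hl huv
    | cons => simp
  · intro x e₁ h1 e₂ h2
    exact hM x e₁ (Finset.mem_inter.1 h1).2 e₂ (Finset.mem_inter.1 h2).2
  · intro x e₁ h1 e₂ h2
    rw [Finset.mem_sdiff, List.mem_toFinset] at h1 h2
    exact eq_of_altChain hX hn hc x e₁ h1.1 e₂ h2.1 h1.2 h2.2
  · intro e he
    exact edges_mem_of_altChain hc e (List.mem_toFinset.1 he)

theorem altChain_of_altCond {X : Set V} {E M : Finset (Sym2 V)} (hX : Crosses X E) {x y : V}
    {l : List V} (hn : (x :: y :: l).Nodup) (hE : ∀ e ∈ pathEdges (x :: y :: l), e ∈ E)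
    (hM : ∀ z : V, ∀ e₁ ∈ pathEdges (x :: y :: l), ∀ e₂ ∈ pathEdges (x :: y :: l),
      (e₁ ∈ M ↔ e₂ ∈ M) → z ∈ e₁ → z ∈ e₂ → e₁ = e₂)
    (hx : x ∈ X ↔ s(x, y) ∉ M) : (x :: y :: l).IsChain (AltStep X E M) := by
  induction l generalizing x y with
  | nil => exact List.isChain_cons_cons.2 ⟨⟨hE _ (by simp [pathEdges]), hx⟩, by simp⟩
  | cons z l ih =>
    refine List.isChain_cons_cons.2 ⟨⟨hE _ (by simp [pathEdges]), hx⟩, ?_⟩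
    rw [pathEdges_cons_cons] at hE hM
    refine ih (List.nodup_cons.1 hn).2 (fun e he => hE e (List.mem_cons_of_mem _ he))
      (fun v e₁ h1 e₂ h2 => hM v e₁ (List.mem_cons_of_mem _ h1) e₂ (List.mem_cons_of_mem _ h2)) ?_
    have hne : s(x, y) ≠ s(y, z) := by
      intro h
      have : x ∈ s(y, z) := h ▸ Sym2.mem_mk_left x y
      have := Sym2.mem_iff.1 this
      simp at hn
      tauto
    have h1 := hX x y (hE _ (by simp))
    have h2 : ¬ (s(x, y) ∈ M ↔ s(y, z) ∈ M) := fun h =>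
      hne (hM y _ (by simp) _ (by simp [pathEdges]) h (by simp) (by simp))
    tauto

open Classical in
theorem IsAltPath.reach_or {X : Set V} {E M P : Finset (Sym2 V)} {u v : V}
    (h : IsAltPath E M P u v) (hX : Crosses X E) :
    (Relation.ReflTransGen (AltStep X E M) u v ∨
      Relation.ReflTransGen (AltStep X E M) v u ∧
        (P ∩ M).card + (if u ∈ X then 0 else 1) = (P \ M).card + (if v ∈ X then 0 else 1)) := by
  obtain ⟨⟨l, hn, h2, hu, hv, hE, rfl⟩, hc1, hc2⟩ := h
  match l, h2 with
  | x :: y :: l, _ =>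
    simp only [List.head?_cons, Option.some.injEq] at hu
    subst hu
    have hM : ∀ z : V, ∀ e₁ ∈ pathEdges (x :: y :: l), ∀ e₂ ∈ pathEdges (x :: y :: l),
      (e₁ ∈ M ↔ e₂ ∈ M) → z ∈ e₁ → z ∈ e₂ → e₁ = e₂ := by
      intro z e₁ h1 e₂ h2 h3
      by_cases h4 : e₁ ∈ M
      · exact hc1 z e₁ (Finset.mem_inter.2 ⟨List.mem_toFinset.2 h1, h4⟩) e₂
          (Finset.mem_inter.2 ⟨List.mem_toFinset.2 h2, h3.1 h4⟩)
      · exact hc2 z e₁ (Finset.mem_sdiff.2 ⟨List.mem_toFinset.2 h1, h4⟩) e₂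
          (Finset.mem_sdiff.2 ⟨List.mem_toFinset.2 h2, fun h => h4 (h3.2 h)⟩)
    by_cases hx : x ∈ X ↔ s(x, y) ∉ M
    · exact .inl (reach_of_chain (altChain_of_altCond hX hn hE hM hx) hv)
    · have hch := altChain_of_altCond hX.compl hn hE hM (by simp only [Set.mem_compl_iff]; tauto)
      refine .inr ⟨?_, ?_⟩
      · simpa using reach_swap hX.compl (reach_of_chain hch hv)
      · have := card_of_altChain hX.compl hn hch hv
        simpa [ite_not, pathEdges] using this

end AlternatingReachability

section BipartiteMatchings

variable {V : Type*} [DecidableEq V]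

theorem mem_bipEdges {A B : Finset V} {x y : V} :
    s(x, y) ∈ bipEdges A B ↔ (x ∈ A ∧ y ∈ B) ∨ (y ∈ A ∧ x ∈ B) := by
  simp only [bipEdges, Finset.mem_image, Finset.mem_product, Prod.exists, Sym2.eq_iff]
  constructor
  · rintro ⟨a, b, ⟨ha, hb⟩, ⟨rfl, rfl⟩ | ⟨rfl, rfl⟩⟩ <;> tauto
  · rintro (⟨h1, h2⟩ | ⟨h1, h2⟩)
    · exact ⟨x, y, ⟨h1, h2⟩, .inl ⟨rfl, rfl⟩⟩
    · exact ⟨y, x, ⟨h1, h2⟩, .inr ⟨rfl, rfl⟩⟩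

theorem exists_of_mem_bipEdges {A B : Finset V} {e : Sym2 V} (he : e ∈ bipEdges A B) :
    ∃ a ∈ A, ∃ b ∈ B, e = s(a, b) := by
  simp only [bipEdges, Finset.mem_image, Finset.mem_product, Prod.exists] at he
  obtain ⟨a, b, ⟨ha, hb⟩, rfl⟩ := he
  exact ⟨a, ha, b, hb, rfl⟩

theorem crosses_of_subset {A B : Finset V} {E : Finset (Sym2 V)} (hAB : Disjoint A B)
    (hE : E ⊆ bipEdges A B) : Crosses (B : Set V) E := by
  intro x y h
  have h1 := mem_bipEdges.1 (hE h)
  have hx := fun h : x ∈ A => Finset.disjoint_left.1 hAB h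
  have hy := fun h : y ∈ A => Finset.disjoint_left.1 hAB h
  simp only [Finset.mem_coe]
  tauto

theorem IsMCM.exists_agent {A B : Finset V} {M : Finset (Sym2 V)} (hAB : Disjoint A B)
    (hcard : B.card ≤ A.card) (hM : IsMCM (bipEdges A B) M) {b : V} (hb : b ∈ B) :
    ∃ a ∈ A, s(a, b) ∈ M := by
  by_contra! hfree
  have hcov : ∀ a ∈ A, ∃ b' ∈ B.erase b, s(a, b') ∈ M := by
    by_contra! h
    obtain ⟨a, ha, h⟩ := h
    have hb' : ∀ e ∈ M, b ∉ e := by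
      intro e he hbe
      obtain ⟨x, hx, y, hy, rfl⟩ := exists_of_mem_bipEdges (hM.1.1 he)
      rcases Sym2.mem_iff.1 hbe with rfl | rfl
      · exact Finset.disjoint_left.1 hAB hx hb
      · exact hfree x hx he
    have ha' : ∀ e ∈ M, a ∉ e := by
      intro e he hae
      obtain ⟨x, hx, y, hy, rfl⟩ := exists_of_mem_bipEdges (hM.1.1 he)
      rcases Sym2.mem_iff.1 hae with rfl | rfl
      · refine h y (Finset.mem_erase.2 ⟨?_, hy⟩) he
        rintro rfl
        exact hb' _ he (by simp)
      · exact Finset.disjoint_left.1 hAB ha hy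
    have hins : IsMatching (bipEdges A B) (insert s(a, b) M) := by
      refine ⟨Finset.insert_subset (mem_bipEdges.2 (.inl ⟨ha, hb⟩)) hM.1.1, ?_⟩
      intro v e₁ h1 e₂ h2 hv1 hv2
      rcases Finset.mem_insert.1 h1 with rfl | hm1 <;> rcases Finset.mem_insert.1 h2 with rfl | hm2
      · rfl
      · rcases Sym2.mem_iff.1 hv1 with rfl | rfl
        · exact (ha' _ hm2 hv2).elim
        · exact (hb' _ hm2 hv2).elim
      · rcases Sym2.mem_iff.1 hv2 with rfl | rfl
        · exact (ha' _ hm1 hv1).elim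
        · exact (hb' _ hm1 hv1).elim
      · exact hM.1.2 v e₁ hm1 e₂ hm2 hv1 hv2
    have := hM.2 _ hins
    rw [Finset.card_insert_of_notMem (hfree a ha)] at this
    omega
  choose! f hf hfM using hcov
  have h1 : A.card ≤ (B.erase b).card := Finset.card_le_card_of_injOn f hf (by
    intro x hx y hy hxy
    exact hM.1.left_eq (hfM x hx) (hxy ▸ hfM y hy))
  have := Finset.card_erase_lt_of_mem hb
  omega

theorem IsMatching.card_le {A B : Finset V} {M : Finset (Sym2 V)}
    (hM : IsMatching (bipEdges A B) M) : M.card ≤ B.card := by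
  have h : ∀ e ∈ M, ∃ b ∈ B, b ∈ e := by
    intro e he
    obtain ⟨x, hx, y, hy, rfl⟩ := exists_of_mem_bipEdges (hM.1 he)
    exact ⟨y, hy, by simp⟩
  rcases M.eq_empty_or_nonempty with rfl | ⟨e₀, he₀⟩
  · simp
  have : Nonempty V := ⟨(h e₀ he₀).choose⟩
  choose! f hf hfe using h
  refine Finset.card_le_card_of_injOn f hf ?_
  intro x hx y hy hxy
  exact hM.2 _ x hx y hy (hfe x hx) (hxy ▸ hfe y hy)

theorem isMCM_image {A B : Finset V} (hAB : Disjoint A B) {g : V → V} (hg : ∀ b ∈ B, g b ∈ A)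
    (hinj : Set.InjOn g B) : IsMCM (bipEdges A B) (B.image fun b => s(g b, b)) := by
  have hne : ∀ b ∈ B, ∀ b' ∈ B, g b ≠ b' := fun b hb b' hb' h =>
    Finset.disjoint_left.1 hAB (hg b hb) (h ▸ hb')
  refine ⟨⟨?_, ?_⟩, ?_⟩
  · intro e he
    obtain ⟨b, hb, rfl⟩ := Finset.mem_image.1 he
    exact mem_bipEdges.2 (.inl ⟨hg b hb, hb⟩)
  · intro v e₁ h1 e₂ h2 hv1 hv2
    obtain ⟨b, hb, rfl⟩ := Finset.mem_image.1 h1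
    obtain ⟨c, hc, rfl⟩ := Finset.mem_image.1 h2
    have : b = c := by
      rcases Sym2.mem_iff.1 hv1 with rfl | rfl <;> rcases Sym2.mem_iff.1 hv2 with h | h
      · exact hinj hb hc h
      · exact (hne _ hb _ hc h).elim
      · exact (hne _ hc _ hb h.symm).elim
      · exact h
    rw [this]
  · intro M' hM'
    rw [Finset.card_image_of_injOn]
    · exact hM'.card_le
    · intro b hb c hc h
      rcases Sym2.eq_iff.1 h with ⟨_, h⟩ | ⟨h, _⟩
      · exact h
      · exact (hne _ hb _ hc h).elim

theorem exists_injection_of_reach {A B : Finset V} (hAB : Disjoint A B) {H N : Finset (Sym2 V)}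
    (hH : H ⊆ bipEdges A B) (hN : IsMatching H N) {a₀ b₀ : V}
    (hcov : ∀ b ∈ B, b ≠ b₀ → ∃ a ∈ A, s(a, b) ∈ N) (ha₀ : a₀ ∈ A) (hb₀ : b₀ ∈ B)
    (hfree : ∀ b, s(a₀, b) ∉ N) (hreach : Relation.ReflTransGen (AltStep (B : Set V) H N) b₀ a₀) :
    ∃ g : V → V, (∀ b ∈ B, g b ∈ A ∧ s(g b, b) ∈ H) ∧ Set.InjOn g B := by
  have hX := crosses_of_subset hAB hH
  let t : B → Finset V := fun b => A.filter fun a => s(a, b.1) ∈ H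
  have hall : ∀ S : Finset B, S.card ≤ (S.biUnion t).card := by
    intro S
    by_contra! hlt
    choose! m hmA hmN using hcov
    have hinj : Set.InjOn (fun b : B => m b) (S.filter fun b => b.1 ≠ b₀) := by
      intro x hx y hy hxy
      simp only [Finset.coe_filter, Set.mem_ofPred_eq] at hx hy
      have h1 := hmN x x.2 hx.2
      have h2 := hmN y y.2 hy.2
      simp only at hxy
      rw [← hxy] at h2
      exact Subtype.ext (hN.right_eq h1 h2)
    have hsub : (S.filter fun b => b.1 ≠ b₀).image (fun b : B => m b) ⊆ S.biUnion t := by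
      intro a ha
      simp only [Finset.mem_image, Finset.mem_filter] at ha
      obtain ⟨b, ⟨hb, hne⟩, rfl⟩ := ha
      exact Finset.mem_biUnion.2 ⟨b, hb, Finset.mem_filter.2
        ⟨hmA b b.2 hne, hN.1 (hmN b b.2 hne)⟩⟩
    have hcard : S.card ≤ (S.filter fun b => b.1 ≠ b₀).card + 1 := by
      have h1 : S ⊆ insert ⟨b₀, hb₀⟩ (S.filter fun b => b.1 ≠ b₀) := by
        intro b hb
        by_cases h : b.1 = b₀
        · exact Finset.mem_insert.2 (.inl (Subtype.ext h))
        · exact Finset.mem_insert_of_mem (Finset.mem_filter.2 ⟨hb, h⟩)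
      exact (Finset.card_le_card h1).trans (Finset.card_insert_le _ _)
    have hb₀S : (⟨b₀, hb₀⟩ : B) ∈ S := by
      by_contra hmem
      have h1 : (S.filter fun b => b.1 ≠ b₀) = S := by
        refine Finset.filter_true_of_mem fun b hb h => hmem ?_
        have : b = ⟨b₀, hb₀⟩ := Subtype.ext h
        exact this ▸ hb
      have h2 := Finset.card_le_card hsub
      rw [Finset.card_image_of_injOn hinj, h1] at h2
      omega
    have heq : (S.filter fun b => b.1 ≠ b₀).image (fun b : B => m b) = S.biUnion t := by
      refine Finset.eq_of_subset_of_card_le hsub ?_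
      rw [Finset.card_image_of_injOn hinj]
      omega
    have hclosed : ∀ x, Relation.ReflTransGen (AltStep (B : Set V) H N) b₀ x →
        (∀ h : x ∈ B, (⟨x, h⟩ : B) ∈ S) ∧ (x ∉ B → x ∈ S.biUnion t) := by
      intro x hx
      induction hx with
      | refl => exact ⟨fun _ => hb₀S, fun h => absurd hb₀ h⟩
      | @tail x y _ hxy ih =>
        have h1 := hX x y hxy.1
        have h2 := hxy.2
        simp only [Finset.mem_coe] at h1 h2
        by_cases hx : x ∈ B
        · have hy : y ∉ B := h1.1 hx
          refine ⟨fun h => absurd h hy, fun _ => ?_⟩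
          have h3 := mem_bipEdges.1 (hH hxy.1)
          refine Finset.mem_biUnion.2 ⟨⟨x, hx⟩, ih.1 hx, Finset.mem_filter.2 ⟨by tauto, ?_⟩⟩
          rw [Sym2.eq_swap]
          exact hxy.1
        · have hy : y ∈ B := by tauto
          have hxN : s(x, y) ∈ N := by tauto
          refine ⟨fun _ => ?_, fun h => absurd hy h⟩
          have h3 := ih.2 hx
          rw [← heq] at h3
          simp only [Finset.mem_image, Finset.mem_filter] at h3
          obtain ⟨b, ⟨hb, hne⟩, rfl⟩ := h3
          have : b = ⟨y, hy⟩ := Subtype.ext (hN.right_eq (hmN b b.2 hne) hxN)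
          exact this ▸ hb
    have h1 := (hclosed a₀ hreach).2 (Finset.disjoint_left.1 hAB ha₀)
    rw [← heq] at h1
    simp only [Finset.mem_image, Finset.mem_filter] at h1
    obtain ⟨b, ⟨hb, hne⟩, rfl⟩ := h1
    exact hfree b (hmN b b.2 hne)
  obtain ⟨f, hf, hft⟩ := (Finset.all_card_le_biUnion_card_iff_exists_injective t).1 hall
  refine ⟨fun b => if h : b ∈ B then f ⟨b, h⟩ else b, ?_, ?_⟩
  · intro b hb
    have := hft ⟨b, hb⟩
    simpa [hb, t] using this
  · intro x hx y hy hxy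
    simp only [Finset.mem_coe] at hx hy
    simp only [hx, hy, dite_true] at hxy
    exact congrArg Subtype.val (hf hxy)

open Classical in
theorem exists_reach_of_injection {A B : Finset V} (hAB : Disjoint A B) {H N : Finset (Sym2 V)}
    (hH : H ⊆ bipEdges A B) (hN : IsMatching H N) {b₀ : V} (hb₀ : b₀ ∈ B)
    (hfree : ∀ a, s(a, b₀) ∉ N) {g : V → V} (hg : ∀ b ∈ B, g b ∈ A ∧ s(g b, b) ∈ H)
    (hinj : Set.InjOn g B) :
    ∃ a ∈ A, (∀ b, s(a, b) ∉ N) ∧ Relation.ReflTransGen (AltStep (B : Set V) H N) b₀ a := by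
  by_contra! hno
  have hX := crosses_of_subset hAB hH
  let R := B.filter fun b => Relation.ReflTransGen (AltStep (B : Set V) H N) b₀ b
  let T := A.filter fun a => Relation.ReflTransGen (AltStep (B : Set V) H N) b₀ a
  have h1 : R.card ≤ T.card := by
    refine Finset.card_le_card_of_injOn g ?_ (hinj.mono (Finset.coe_subset.2 (Finset.filter_subset _ _)))
    intro b hb
    simp only [R, Finset.coe_filter, Set.mem_ofPred_eq] at hb
    obtain ⟨hbB, hb⟩ := hb
    have hgb := hg b hbB
    simp only [T, Finset.coe_filter, Set.mem_ofPred_eq]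
    refine ⟨hgb.1, ?_⟩
    by_cases hbN : s(g b, b) ∈ N
    · rcases hb.cases_tail with rfl | ⟨c, hc, hcb⟩
      · exact (hfree _ hbN).elim
      · have h2 := hX c b hcb.1
        have h3 := hcb.2
        simp only [Finset.mem_coe] at h2 h3
        have : s(c, b) ∈ N := by tauto
        rwa [hN.left_eq hbN this]
    · rw [Sym2.eq_swap] at hgb hbN
      exact hb.tail ⟨hgb.2, by simp [hbB, hbN]⟩
  have h2 : T.card ≤ (R.erase b₀).card := by
    have h : ∀ a ∈ T, ∃ b ∈ R.erase b₀, s(a, b) ∈ N := by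
      intro a ha
      obtain ⟨haA, ha⟩ := Finset.mem_filter.1 ha
      have : ∃ b, s(a, b) ∈ N := by
        by_contra! h
        exact hno a haA h ha
      obtain ⟨b, hb⟩ := this
      have haB := Finset.disjoint_left.1 hAB haA
      refine ⟨b, Finset.mem_erase.2 ⟨?_, Finset.mem_filter.2 ⟨?_, ?_⟩⟩, hb⟩
      · rintro rfl
        exact hfree _ hb
      · have := hX a b (hN.1 hb)
        simp only [Finset.mem_coe] at this
        tauto
      · exact ha.tail ⟨hN.1 hb, by simp [haB, hb]⟩
    choose! f hf hfN using h
    refine Finset.card_le_card_of_injOn f hf ?_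
    intro x hx y hy hxy
    exact hN.left_eq (hfN x hx) (hxy ▸ hfN y hy)
  have h3 : (R.erase b₀).card < R.card :=
    Finset.card_erase_lt_of_mem (Finset.mem_filter.2 ⟨hb₀, .refl⟩)
  omega

end BipartiteMatchings

section Clusters

variable {V : Type*} [DecidableEq V]

theorem phi_subset {E M : Finset (Sym2 V)} {w : Sym2 V → ℝ} (hM : M ⊆ E) : phi E w M ⊆ E := by
  classical
  intro e he
  simp only [phi, Finset.mem_union, Finset.mem_filter] at he
  exact he.elim (fun h => hM h) And.left

theorem not_reach_of_crit {A B : Finset V} (hAB : Disjoint A B) {w : Sym2 V → ℝ}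
    {M : Finset (Sym2 V)} (hM : IsMatching (bipEdges A B) M) {a b f : V} (hb : b ∈ B)
    (hcrit : IsCritBotEdge (bipEdges A B) w M s(a, b)) (hf : f ∈ A)
    (hfree : ∀ y, s(f, y) ∈ M → s(f, y) = s(a, b)) :
    ¬ Relation.ReflTransGen (AltStep (B : Set V) (phi (bipEdges A B) w M \ {s(a, b)}) M) b f := by
  intro h
  have hX : Crosses (B : Set V) (phi (bipEdges A B) w M \ {s(a, b)}) :=
    crosses_of_subset hAB (Finset.sdiff_subset.trans (phi_subset hM.1))
  have h' : Relation.ReflTransGen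
      (AltStep (B : Set V) (phi (bipEdges A B) w M \ {s(a, b)}) (M \ {s(a, b)})) b f := by
    refine Relation.ReflTransGen.mono (fun x y hxy => ⟨hxy.1, ?_⟩) b f h
    have h1 := (Finset.mem_sdiff.1 hxy.1).2
    rw [hxy.2, Finset.mem_sdiff]
    tauto
  have hbf : b ≠ f := by
    rintro rfl
    exact Finset.disjoint_left.1 hAB hf hb
  obtain ⟨P, hP, -, -⟩ := exists_altPath_of_reach hX (fun v e₁ h1 e₂ h2 =>
    hM.2 v e₁ (Finset.mem_sdiff.1 h1).1 e₂ (Finset.mem_sdiff.1 h2).1) h' hbf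
  refine hcrit.2 ⟨P, b, f, hP, ?_, ?_⟩
  · intro e he hbe
    rw [Finset.mem_sdiff, Finset.mem_singleton] at he
    exact he.2 (hM.2 b e he.1 _ hcrit.1.1 hbe (by simp))
  · intro e he hfe
    rw [Finset.mem_sdiff, Finset.mem_singleton] at he
    obtain ⟨y, rfl⟩ := hfe
    exact he.2 (hfree y he.1)

theorem reach_avoiding_of_reach_from {A B : Finset V} (hAB : Disjoint A B)
    {E M : Finset (Sym2 V)} (hE : E ⊆ bipEdges A B) {a b x : V} (ha : a ∈ A)
    (heM : s(a, b) ∈ M) (h : Relation.ReflTransGen (AltStep (B : Set V) E M) b x) :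
    Relation.ReflTransGen (AltStep (B : Set V) (E \ {s(a, b)}) M) b x := by
  induction h with
  | refl => exact .refl
  | @tail x y _ hxy ih =>
    by_cases he : s(x, y) = s(a, b)
    · rcases Sym2.eq_iff.1 he with ⟨rfl, rfl⟩ | ⟨rfl, rfl⟩
      · exact .refl
      · have h1 := crosses_of_subset hAB hE _ _ hxy.1
        have h2 := hxy.2
        have h3 := Finset.disjoint_left.1 hAB ha
        rw [Sym2.eq_swap] at heM
        simp only [Finset.mem_coe] at h1 h2
        tauto
    · exact ih.tail ⟨Finset.mem_sdiff.2 ⟨hxy.1, by simpa using he⟩, hxy.2⟩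

theorem reach_of_reach_to {A B : Finset V} (hAB : Disjoint A B)
    {E M : Finset (Sym2 V)} (hE : E ⊆ bipEdges A B) (hM : IsMatching (bipEdges A B) M)
    {a b v : V} (ha : a ∈ A) (hb : b ∈ B) (heM : s(a, b) ∈ M) (hv : v ≠ b)
    (h : Relation.ReflTransGen (AltStep (B : Set V) E M) v b) :
    Relation.ReflTransGen (AltStep (B : Set V) (E \ {s(a, b)}) M) v a := by
  have hX := crosses_of_subset hAB hE
  have ha' := Finset.disjoint_left.1 hAB ha
  have key : ∀ x, Relation.ReflTransGen (AltStep (B : Set V) E M) v x →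
      Relation.ReflTransGen (AltStep (B : Set V) (E \ {s(a, b)}) M) v a ∨
      Relation.ReflTransGen (AltStep (B : Set V) (E \ {s(a, b)}) M) v x := by
    intro x hx
    induction hx with
    | refl => exact .inr .refl
    | @tail x y _ hxy ih =>
      rcases ih with ih | ih
      · exact .inl ih
      by_cases he : s(x, y) = s(a, b)
      · rcases Sym2.eq_iff.1 he with ⟨rfl, rfl⟩ | ⟨rfl, rfl⟩
        · exact .inl ih
        · have h2 := hxy.2
          rw [Sym2.eq_swap] at heM
          simp only [Finset.mem_coe] at h2
          tauto
      · exact .inr (ih.tail ⟨Finset.mem_sdiff.2 ⟨hxy.1, by simpa using he⟩, hxy.2⟩)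
  rcases key b h with h | h
  · exact h
  · rcases h.cases_tail with h | ⟨c, -, hcb⟩
    · exact absurd h.symm hv
    · have h0 := Finset.mem_sdiff.1 hcb.1
      have h1 := hX c b h0.1
      have h2 := hcb.2
      simp only [Finset.mem_coe] at h1 h2
      have h3 : s(c, b) ∈ M := by tauto
      rw [hM.left_eq h3 heM] at h0
      simp at h0

theorem IsBotCluster.reach_or {A B : Finset V} (hAB : Disjoint A B) {w : Sym2 V → ℝ}
    {M : Finset (Sym2 V)} (hM : IsMatching (bipEdges A B) M) {a b v : V} (ha : a ∈ A)
    (hb : b ∈ B) (heM : s(a, b) ∈ M) (hclus : IsBotCluster A B w M b) (hv : v ∈ A) :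
    Relation.ReflTransGen (AltStep (B : Set V) (phi (bipEdges A B) w M \ {s(a, b)}) M) b v ∨
    Relation.ReflTransGen (AltStep (B : Set V) (phi (bipEdges A B) w M \ {s(a, b)}) M) v a := by
  have hvb : v ≠ b := by
    rintro rfl
    exact Finset.disjoint_left.1 hAB hv hb
  obtain ⟨P, hP⟩ := hclus v (Finset.mem_union_left _ hv) hvb
  have hE := phi_subset (w := w) hM.1
  rcases hP.reach_or (crosses_of_subset hAB hE) with h | ⟨h, -⟩
  · exact .inr (reach_of_reach_to hAB hE hM ha hb heM hvb h)
  · exact .inl (reach_avoiding_of_reach_from hAB hE ha heM h)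

theorem exists_task_of_cluster {A B : Finset V} (hAB : Disjoint A B) {w : Sym2 V → ℝ}
    {M : Finset (Sym2 V)} (hM : IsMatching (bipEdges A B) M) {a b f : V} (ha : a ∈ A)
    (hb : b ∈ B) (hcrit : IsCritBotEdge (bipEdges A B) w M s(a, b))
    (hclus : IsBotCluster A B w M b) (hf : f ∈ A) : ∃ y, s(f, y) ∈ M := by
  by_contra! hno
  rcases hclus.reach_or hAB hM ha hb hcrit.1.1 hf with h | h
  · exact not_reach_of_crit hAB hM hb hcrit hf (fun y hy => absurd hy (hno y)) h
  · rcases h.cases_head with rfl | ⟨c, hc, -⟩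
    · exact hno _ hcrit.1.1
    · have := hc.2
      have hfB := Finset.disjoint_left.1 hAB hf
      have := hno c
      simp only [Finset.mem_coe] at *
      tauto

theorem mem_Vnu_iff {A B : Finset V} (hAB : Disjoint A B) {w : Sym2 V → ℝ}
    {M : Finset (Sym2 V)} (hM : IsMatching (bipEdges A B) M) {a b v : V}
    (heM : s(a, b) ∈ M) (hb : b ∈ B) (hv : v ∈ A ∪ B) :
    v ∈ Vnu A B w M a b ↔
      Relation.ReflTransGen (AltStep (B : Set V) (phi (bipEdges A B) w M \ {s(a, b)}) M) b v := by
  have hX : Crosses (B : Set V) (phi (bipEdges A B) w M \ {s(a, b)}) :=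
    crosses_of_subset hAB (Finset.sdiff_subset.trans (phi_subset hM.1))
  constructor
  · rintro (rfl | ⟨-, P, hP⟩)
    · exact .refl
    · rcases hP.reach_or hX with h | ⟨h, -⟩
      · rcases h.cases_tail with rfl | ⟨c, -, hcb⟩
        · exact .refl
        · have h1 := hX c b hcb.1
          have h2 := hcb.2
          simp only [Finset.mem_coe] at h1 h2
          have h3 : s(c, b) ∈ M := by tauto
          have h4 := (Finset.mem_sdiff.1 hcb.1).2
          rw [hM.left_eq h3 heM] at h4
          simp at h4
      · exact h
  · intro h
    by_cases hvb : v = b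
    · exact .inl hvb
    · obtain ⟨P, hP, -, -⟩ := exists_altPath_of_reach hX.compl hM.2 (reach_swap hX h) hvb
      exact .inr ⟨hv, P, hP⟩

theorem exists_injection_of_isOptMCM {A B : Finset V} (hAB : Disjoint A B)
    (hcard : B.card ≤ A.card) {w : Sym2 V → ℝ} {τ : ℝ} {e : Sym2 V}
    (he : IsBottleneckEdge (bipEdges A B) w e) (hlt : w e < τ) :
    ∃ g : V → V, (∀ b ∈ B, g b ∈ A ∧ s(g b, b) ∈ (bipEdges A B).filter (w · < τ)) ∧
      Set.InjOn g B := by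
  obtain ⟨M, hM, hmax⟩ := he
  have hcov : ∀ b ∈ B, ∃ a ∈ A, s(a, b) ∈ M := fun b hb => hM.1.exists_agent hAB hcard hb
  choose! g hgA hgM using hcov
  refine ⟨g, fun b hb => ⟨hgA b hb, Finset.mem_filter.2
    ⟨hM.1.1.1 (hgM b hb), (hmax.2 _ (hgM b hb)).trans_lt hlt⟩⟩, ?_⟩
  intro x hx y hy hxy
  exact hM.1.1.right_eq (hgM x hx) (hxy ▸ hgM y hy)

theorem weight_lt_of_injection {A B : Finset V} (hAB : Disjoint A B) (hB : B.Nonempty)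
    {w : Sym2 V → ℝ} {τ : ℝ} {e : Sym2 V} (he : IsBottleneckEdge (bipEdges A B) w e) {g : V → V}
    (hg : ∀ b ∈ B, g b ∈ A ∧ s(g b, b) ∈ (bipEdges A B).filter (w · < τ))
    (hinj : Set.InjOn g B) : w e < τ := by
  obtain ⟨M, hM, hmax⟩ := he
  obtain ⟨e', he', hmax'⟩ := Finset.exists_max_image (B.image fun b => s(g b, b)) w (hB.image _)
  refine (hM.2 _ e e' (isMCM_image hAB (fun b hb => (hg b hb).1) hinj) hmax
    ⟨he', hmax'⟩).trans_lt ?_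
  obtain ⟨b, hb, rfl⟩ := Finset.mem_image.1 he'
  exact (Finset.mem_filter.1 (hg b hb).2).2

end Clusters

set_option maxHeartbeats 2000000 in
/-- **Theorem 2.** Suppose `G1` and `G2` are bottleneck clusters relative to the critical
bottleneck edges `e1 = {a1, b1}` and `e2 = {a2, b2}` of `M1` and `M2` respectively, `e1` is
the unique element of `argmax_{e ∈ M1} w e`, and `w e1 > w e2`. Then a bottleneck edge `e3`
of the combined graph `G3` satisfies `w e3 < w e1` if and only if there exist an agent
`i ∈ A2` and a task `j ∈ B2` such that
(i) some task `b' ∈ V_ν ∩ B1` has `w {i, b'} < w e1`,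
(ii) some agent `a' ∈ V_μ ∩ A1` has `w {j, a'} < w e1`, and
(iii) there is an alternating path `P` relative to `M2` between `i` and `j` all of whose
edges have weight less than `w e1`, with `|P ∩ M2| > |P \ M2|`. -/
theorem reduce_iff {V : Type*} [DecidableEq V]
    (A1 A2 B1 B2 : Finset V)
    (hA1A2 : Disjoint A1 A2) (hA1B1 : Disjoint A1 B1) (hA1B2 : Disjoint A1 B2)
    (hA2B1 : Disjoint A2 B1) (hA2B2 : Disjoint A2 B2) (hB1B2 : Disjoint B1 B2)
    (hB1 : 1 ≤ B1.card) (hA1 : B1.card ≤ A1.card)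
    (hB2 : 1 ≤ B2.card) (hA2 : B2.card ≤ A2.card)
    (w : Sym2 V → ℝ) (M1 M2 : Finset (Sym2 V))
    (a1 b1 a2 b2 : V) (ha1 : a1 ∈ A1) (hb1 : b1 ∈ B1) (ha2 : a2 ∈ A2) (hb2 : b2 ∈ B2)
    (hM1 : IsOptMCM (bipEdges A1 B1) w M1) (he1M : s(a1, b1) ∈ M1)
    (hcrit1 : IsCritBotEdge (bipEdges A1 B1) w M1 s(a1, b1))
    (huniq : ∀ e, IsMaxEdge w M1 e → e = s(a1, b1))
    (hclus1 : IsBotCluster A1 B1 w M1 b1)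
    (hM2 : IsOptMCM (bipEdges A2 B2) w M2) (he2M : s(a2, b2) ∈ M2)
    (hcrit2 : IsCritBotEdge (bipEdges A2 B2) w M2 s(a2, b2))
    (hclus2 : IsBotCluster A2 B2 w M2 b2)
    (hw12 : w s(a2, b2) < w s(a1, b1))
    (e3 : Sym2 V)
    (he3 : IsBottleneckEdge (bipEdges (A1 ∪ A2) (B1 ∪ B2)) w e3) :
    w e3 < w s(a1, b1) ↔
    ∃ i ∈ A2, ∃ j ∈ B2,
      (∃ b', b' ∈ Vnu A1 B1 w M1 a1 b1 ∧ b' ∈ B1 ∧ w s(i, b') < w s(a1, b1)) ∧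
      (∃ a', a' ∈ Vmu A1 B1 w M1 a1 b1 ∧ a' ∈ A1 ∧ w s(j, a') < w s(a1, b1)) ∧
      (∃ P, IsAltPath (bipEdges (A1 ∪ A2) (B1 ∪ B2)) M2 P i j ∧
        (∀ e ∈ P, w e < w s(a1, b1)) ∧ (P \ M2).card < (P ∩ M2).card) := by
  have hM1m := hM1.1.1
  have hM2m := hM2.1.1
  have hA3B3 : Disjoint (A1 ∪ A2) (B1 ∪ B2) := by
    simp only [Finset.disjoint_union_left, Finset.disjoint_union_right]
    exact ⟨⟨hA1B1, hA2B1⟩, hA1B2, hA2B2⟩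
  have d1 : ∀ x ∈ A1, x ∉ A2 := fun _ h => Finset.disjoint_left.1 hA1A2 h
  have d2 : ∀ x ∈ A1, x ∉ B1 := fun _ h => Finset.disjoint_left.1 hA1B1 h
  have d3 : ∀ x ∈ A1, x ∉ B2 := fun _ h => Finset.disjoint_left.1 hA1B2 h
  have d4 : ∀ x ∈ A2, x ∉ B1 := fun _ h => Finset.disjoint_left.1 hA2B1 h
  have d5 : ∀ x ∈ A2, x ∉ B2 := fun _ h => Finset.disjoint_left.1 hA2B2 h
  have d6 : ∀ x ∈ B1, x ∉ B2 := fun _ h => Finset.disjoint_left.1 hB1B2 h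
  have m1 : ∀ {x y}, s(x, y) ∈ M1 → (x ∈ A1 ∧ y ∈ B1) ∨ (y ∈ A1 ∧ x ∈ B1) :=
    fun h => mem_bipEdges.1 (hM1m.1 h)
  have m2 : ∀ {x y}, s(x, y) ∈ M2 → (x ∈ A2 ∧ y ∈ B2) ∨ (y ∈ A2 ∧ x ∈ B2) :=
    fun h => mem_bipEdges.1 (hM2m.1 h)
  set τ := w s(a1, b1) with hτ
  set F := phi (bipEdges A1 B1) w M1 \ {s(a1, b1)} with hF
  set H := (bipEdges (A1 ∪ A2) (B1 ∪ B2)).filter (w · < τ) with hH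
  set N := (M1 \ {s(a1, b1)}) ∪ M2 with hN
  have hHsub : H ⊆ bipEdges (A1 ∪ A2) (B1 ∪ B2) := Finset.filter_subset _ _
  have hX := crosses_of_subset hA3B3 hHsub
  have memH : ∀ {x y}, s(x, y) ∈ H ↔ ((x ∈ A1 ∪ A2 ∧ y ∈ B1 ∪ B2) ∨
      (y ∈ A1 ∪ A2 ∧ x ∈ B1 ∪ B2)) ∧ w s(x, y) < τ := by
    intro x y
    rw [hH, Finset.mem_filter, mem_bipEdges]
  have wM1 : ∀ e ∈ M1, e ≠ s(a1, b1) → w e < τ := by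
    intro e he hne
    refine lt_of_le_of_ne (hcrit1.1.2 e he) fun heq => hne (huniq e ⟨he, fun e' he' => ?_⟩)
    rw [heq]
    exact hcrit1.1.2 e' he'
  have memF : ∀ {x y}, s(x, y) ∈ F ↔ ((x ∈ A1 ∧ y ∈ B1) ∨ (y ∈ A1 ∧ x ∈ B1)) ∧
      w s(x, y) < τ := by
    intro x y
    rw [← mem_bipEdges]
    simp only [hF, phi, Finset.mem_sdiff, Finset.mem_union, Finset.mem_filter,
      Finset.mem_singleton]
    constructor
    · rintro ⟨h | ⟨h, e', he', hlt⟩, hne⟩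
      · exact ⟨hM1m.1 h, wM1 _ h hne⟩
      · exact ⟨h, hlt.trans_le (hcrit1.1.2 _ he'.1)⟩
    · rintro ⟨h, hlt⟩
      exact ⟨.inr ⟨h, _, hcrit1.1, hlt⟩, fun heq => hlt.ne (heq ▸ rfl)⟩
  have memN : ∀ {x y}, s(x, y) ∈ N ↔ (s(x, y) ∈ M1 ∧ s(x, y) ≠ s(a1, b1)) ∨ s(x, y) ∈ M2 := by
    intro x y
    simp [hN]
  have hNm : IsMatching H N := by
    constructor
    · rintro ⟨x, y⟩ h
      rcases memN.1 h with ⟨h1, h2⟩ | h1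
      · have := m1 h1
        refine memH.2 ⟨?_, wM1 _ h1 h2⟩
        simp only [Finset.mem_union]
        grind
      · have := m2 h1
        refine memH.2 ⟨?_, (hcrit2.1.2 _ h1).trans_lt hw12⟩
        simp only [Finset.mem_union]
        grind
    · intro v e₁ h1 e₂ h2 hv1 hv2
      obtain ⟨x, rfl⟩ := hv1
      obtain ⟨y, rfl⟩ := hv2
      rcases memN.1 h1 with ⟨h1, -⟩ | h1 <;> rcases memN.1 h2 with ⟨h2, -⟩ | h2
      · exact hM1m.2 v _ h1 _ h2 (by simp) (by simp)
      · have := m1 h1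
        have := m2 h2
        grind
      · have := m2 h1
        have := m1 h2
        grind
      · exact hM2m.2 v _ h1 _ h2 (by simp) (by simp)
  have hb3 : b1 ∈ B1 ∪ B2 := Finset.mem_union_left _ hb1
  have ha3 : a1 ∈ A1 ∪ A2 := Finset.mem_union_left _ ha1
  have hb1free : ∀ a, s(a, b1) ∉ N := by
    intro a h
    rcases memN.1 h with ⟨h1, h2⟩ | h1
    · exact h2 (by rw [hM1m.left_eq h1 he1M])
    · have := m2 h1
      grind
  have ha1free : ∀ b, s(a1, b) ∉ N := by
    intro b h
    rcases memN.1 h with ⟨h1, h2⟩ | h1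
    · exact h2 (by rw [hM1m.right_eq h1 he1M])
    · have := m2 h1
      grind
  have hcov : ∀ b ∈ B1 ∪ B2, b ≠ b1 → ∃ a ∈ A1 ∪ A2, s(a, b) ∈ N := by
    intro b hb hne
    rcases Finset.mem_union.1 hb with hb | hb
    · obtain ⟨a, ha, haM⟩ := hM1.1.exists_agent hA1B1 hA1 hb
      refine ⟨a, Finset.mem_union_left _ ha, memN.2 (.inl ⟨haM, ?_⟩)⟩
      rw [ne_eq, Sym2.eq_iff]
      grind
    · obtain ⟨a, ha, haM⟩ := hM2.1.exists_agent hA2B2 hA2 hb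
      exact ⟨a, Finset.mem_union_right _ ha, memN.2 (.inr haM)⟩
  have hfree : ∀ f ∈ A1 ∪ A2, (∀ b, s(f, b) ∉ N) → f = a1 := by
    intro f hf hno
    rcases Finset.mem_union.1 hf with hf | hf
    · obtain ⟨y, hy⟩ := exists_task_of_cluster hA1B1 hM1m ha1 hb1 hcrit1 hclus1 hf
      by_contra hne
      refine hno y (memN.2 (.inl ⟨hy, ?_⟩))
      rw [ne_eq, Sym2.eq_iff]
      grind
    · obtain ⟨y, hy⟩ := exists_task_of_cluster hA2B2 hM2m ha2 hb2 hcrit2 hclus2 hf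
      exact absurd (memN.2 (.inr hy)) (hno y)
  have step1 : ∀ {x y}, x ∈ A1 ∪ B1 → y ∈ A1 ∪ B1 →
      (AltStep (↑(B1 ∪ B2) : Set V) H N x y ↔ AltStep (B1 : Set V) F M1 x y) := by
    intro x y hx hy
    rw [Finset.mem_union] at hx hy
    have h1 : s(x, y) ∈ H ↔ s(x, y) ∈ F := by
      rw [memH, memF]
      simp only [Finset.mem_union]
      grind
    have h2 : s(x, y) ∈ F → (s(x, y) ∈ N ↔ s(x, y) ∈ M1) := by
      intro h
      have hne : s(x, y) ≠ s(a1, b1) := by simpa using (Finset.mem_sdiff.1 h).2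
      have h3 : s(x, y) ∉ M2 := fun h3 => by
        have := m2 h3
        grind
      rw [memN]
      grind
    have h3 : x ∈ B1 ∪ B2 ↔ x ∈ B1 := by
      rw [Finset.mem_union]
      grind
    unfold AltStep
    rw [h1, Finset.mem_coe, Finset.mem_coe, h3]
    exact and_congr_right fun h => by rw [h2 h]
  have step2 : ∀ {x y}, y ∈ A2 ∪ B2 →
      (AltStep (↑(B1 ∪ B2) : Set V) H N x y ↔ AltStep (↑(B1 ∪ B2) : Set V) H M2 x y) := by
    intro x y hy
    rw [Finset.mem_union] at hy
    have h1 : s(x, y) ∈ N ↔ s(x, y) ∈ M2 := by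
      rw [memN]
      have : s(x, y) ∉ M1 := fun h => by
        have := m1 h
        grind
      grind
    unfold AltStep
    rw [h1]
  have reach1 : ∀ {x y}, x ∈ A1 ∪ B1 → Relation.ReflTransGen (AltStep (B1 : Set V) F M1) x y →
      y ∈ A1 ∪ B1 ∧ Relation.ReflTransGen (AltStep (↑(B1 ∪ B2) : Set V) H N) x y := by
    intro x y hx h
    induction h with
    | refl => exact ⟨hx, .refl⟩
    | @tail y z _ hyz ih =>
      have hz : z ∈ A1 ∪ B1 := by
        have := (memF.1 hyz.1).1
        rw [Finset.mem_union]
        grind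
      exact ⟨hz, ih.2.tail ((step1 ih.1 hz).2 hyz)⟩
  have vnu : ∀ {v}, v ∈ A1 ∪ B1 → (v ∈ Vnu A1 B1 w M1 a1 b1 ↔
      Relation.ReflTransGen (AltStep (B1 : Set V) F M1) b1 v) :=
    fun hv => mem_Vnu_iff hA1B1 hM1m he1M hb1 hv
  have hb1v : b1 ∈ A1 ∪ B1 := Finset.mem_union_right _ hb1
  have hnreach : ¬ Relation.ReflTransGen (AltStep (B1 : Set V) F M1) b1 a1 :=
    not_reach_of_crit hA1B1 hM1m hb1 hcrit1 ha1 fun y hy => by rw [hM1m.right_eq hy he1M]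
  constructor
  · intro hlt
    have hcard : (B1 ∪ B2).card ≤ (A1 ∪ A2).card := by
      rw [Finset.card_union_of_disjoint hB1B2, Finset.card_union_of_disjoint hA1A2]
      omega
    obtain ⟨g, hg, hinj⟩ := exists_injection_of_isOptMCM hA3B3 hcard he3 hlt
    obtain ⟨f, hf, hff, hreach⟩ :=
      exists_reach_of_injection hA3B3 hHsub hNm hb3 hb1free hg hinj
    obtain rfl := hfree f hf hff
    by_contra hgoal
    have key : ∀ x, Relation.ReflTransGen (AltStep (↑(B1 ∪ B2) : Set V) H N) b1 x →
        (x ∈ A1 ∪ B1 ∧ Relation.ReflTransGen (AltStep (B1 : Set V) F M1) b1 x) ∨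
        (x ∈ A2 ∪ B2 ∧ ∃ i ∈ A2, (∃ b', b' ∈ Vnu A1 B1 w M1 f b1 ∧ b' ∈ B1 ∧ w s(i, b') < τ) ∧
          Relation.ReflTransGen (AltStep (↑(B1 ∪ B2) : Set V) H M2) i x) := by
      intro x hx
      induction hx with
      | refl => exact .inl ⟨hb1v, .refl⟩
      | @tail x y _ hxy ih =>
        have hw := memH.1 hxy.1
        have hx1 := hX x y hxy.1
        have hx2 := hxy.2
        simp only [Finset.mem_union, Finset.mem_coe] at hw hx1 hx2
        rcases ih with ⟨hx, ih⟩ | ⟨hx, i, hi, hb', ih⟩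
        · by_cases hy : y ∈ A1 ∪ B1
          · exact .inl ⟨hy, ih.tail ((step1 hx hy).1 hxy)⟩
          · have hno : s(x, y) ∉ N := by
              intro h
              rw [Finset.mem_union] at hx hy
              rcases memN.1 h with ⟨h, -⟩ | h
              · have := m1 h
                grind
              · have := m2 h
                grind
            have hxB := hx2.2 hno
            have hv := (vnu hx).2 ih
            rw [Finset.mem_union] at hx hy
            have hyA : y ∈ A2 := by grind
            refine .inr ⟨Finset.mem_union_left _ hyA, y, hyA, ⟨x, hv, by grind, ?_⟩, .refl⟩
            rw [Sym2.eq_swap]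
            exact hw.2
        · by_cases hy : y ∈ A2 ∪ B2
          · exact .inr ⟨hy, i, hi, hb', ih.tail ((step2 hy).1 hxy)⟩
          · have hno : s(x, y) ∉ N := by
              intro h
              rw [Finset.mem_union] at hx hy
              rcases memN.1 h with ⟨h, -⟩ | h
              · have := m1 h
                grind
              · have := m2 h
                grind
            have hxB := hx2.2 hno
            rw [Finset.mem_union] at hx hy
            have hxB2 : x ∈ B2 := by grind
            have hyA : y ∈ A1 := by grind
            have hyv : y ∈ A1 ∪ B1 := Finset.mem_union_left _ hyA
            by_cases hyr : Relation.ReflTransGen (AltStep (B1 : Set V) F M1) b1 y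
            · exact .inl ⟨hyv, hyr⟩
            · have hix : i ≠ x := by
                rintro rfl
                exact d5 _ hi hxB2
              obtain ⟨P, hP, hPH, hPc⟩ := exists_altPath_of_reach hX hM2m.2 ih hix
              have hi3 : i ∉ (↑(B1 ∪ B2) : Set V) := by
                rw [Finset.mem_coe, Finset.mem_union]
                grind
              have hx3 : x ∈ (↑(B1 ∪ B2) : Set V) := Finset.mem_union_right _ hxB2
              rw [if_neg hi3, if_pos hx3] at hPc
              refine (hgoal ⟨i, hi, x, hxB2, hb', ⟨y, ⟨Finset.mem_coe.2 hyv, fun h =>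
                hyr ((vnu hyv).1 h)⟩, hyA, hw.2⟩, P, ?_, fun e he =>
                (Finset.mem_filter.1 (hPH he)).2, by omega⟩).elim
              obtain ⟨⟨l, h1, h2, h3, h4, h5, h6⟩, hc⟩ := hP
              exact ⟨⟨l, h1, h2, h3, h4, fun e he => hHsub (h5 e he), h6⟩, hc⟩
    rcases key f hreach with ⟨-, h⟩ | ⟨h, -⟩
    · exact hnreach h
    · rw [Finset.mem_union] at h
      grind
  · rintro ⟨i, hi, j, hj, ⟨b', hb'v, hb', hwb⟩, ⟨a', ha'v, ha', hwa⟩, P, hP, hPw, hPc⟩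
    have hPH : IsAltPath H M2 P i j := by
      obtain ⟨⟨l, h1, h2, h3, h4, h5, rfl⟩, hc⟩ := hP
      exact ⟨⟨l, h1, h2, h3, h4, fun e he => Finset.mem_filter.2
        ⟨h5 e he, hPw e (List.mem_toFinset.2 he)⟩, rfl⟩, hc⟩
    have hi3 : i ∉ (↑(B1 ∪ B2) : Set V) := by
      rw [Finset.mem_coe, Finset.mem_union]
      grind
    have hj3 : j ∈ (↑(B1 ∪ B2) : Set V) := Finset.mem_union_right _ hj
    have hij : Relation.ReflTransGen (AltStep (↑(B1 ∪ B2) : Set V) H M2) i j := by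
      rcases hPH.reach_or hX with h | ⟨-, h⟩
      · exact h
      · rw [if_neg hi3, if_pos hj3] at h
        omega
    have key : ∀ x, Relation.ReflTransGen (AltStep (↑(B1 ∪ B2) : Set V) H M2) x j →
        Relation.ReflTransGen (AltStep (↑(B1 ∪ B2) : Set V) H N) x j ∧
          (x ∈ B1 ∪ B2 ∨ x ∈ A2) := by
      intro x hx
      induction hx using Relation.ReflTransGen.head_induction_on with
      | refl => exact ⟨.refl, .inl hj3⟩
      | @head x y hxy _ ih =>
        have hx1 := hX x y hxy.1
        have hx2 := hxy.2
        have hw := (memH.1 hxy.1).1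
        simp only [Finset.mem_coe] at hx1 hx2
        by_cases hxB : x ∈ B1 ∪ B2
        · have hy : y ∈ A2 := ih.2.resolve_left (hx1.1 hxB)
          exact ⟨.head ((step2 (Finset.mem_union_left _ hy)).2 hxy) ih.1, .inl hxB⟩
        · have hxM : s(x, y) ∈ M2 := by grind
          have := m2 hxM
          have hy : x ∈ A2 ∧ y ∈ B2 := by
            rw [Finset.mem_union] at hxB
            grind
          exact ⟨.head ((step2 (Finset.mem_union_right _ hy.2)).2 hxy) ih.1, .inr hy.1⟩
    have hb'u : b' ∈ A1 ∪ B1 := Finset.mem_union_right _ hb'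
    have ha'u : a' ∈ A1 ∪ B1 := Finset.mem_union_left _ ha'
    have r1 := (reach1 hb1v ((vnu hb'u).1 hb'v)).2
    have s1 : AltStep (↑(B1 ∪ B2) : Set V) H N b' i := by
      have hno : s(b', i) ∉ N := by
        intro h
        rcases memN.1 h with ⟨h, -⟩ | h
        · have := m1 h
          grind
        · have := m2 h
          grind
      refine ⟨memH.2 ⟨?_, by rwa [Sym2.eq_swap]⟩, ?_⟩
      · simp only [Finset.mem_union]
        grind
      · simp [hb', hno]
    have s2 : AltStep (↑(B1 ∪ B2) : Set V) H N j a' := by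
      have hno : s(j, a') ∉ N := by
        intro h
        rcases memN.1 h with ⟨h, -⟩ | h
        · have := m1 h
          grind
        · have := m2 h
          grind
      refine ⟨memH.2 ⟨?_, hwa⟩, ?_⟩
      · simp only [Finset.mem_union]
        grind
      · simp [hj, hno]
    have r2 : Relation.ReflTransGen (AltStep (B1 : Set V) F M1) a' a1 := by
      rcases hclus1.reach_or hA1B1 hM1m ha1 hb1 he1M ha' with h | h
      · exact absurd ((vnu ha'u).2 h) ha'v.2
      · exact h
    have hreach := ((r1.tail s1).trans (key i hij).1).trans (.head s2 (reach1 ha'u r2).2)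
    obtain ⟨g, hg, hinj⟩ :=
      exists_injection_of_reach hA3B3 hHsub hNm hcov ha3 hb3 ha1free hreach
    exact weight_lt_of_injection hA3B3 ⟨b1, hb3⟩ he3 hg hinj
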